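/- Let n ≥ 1, let f_1, …, f_n : ℝ^d → ℝ be differentiable convex functions whose gradients are L-Lipschitz (L > 0), let f = (1/n)∑_{i=1}^n f_i, assume f is μ-strongly convex for some μ > 0 (f(x) − f(y) − ⟨∇f(y), x − y⟩ ≥ (μ/2)‖x − y‖² for all x, y), and let x* be the minimizer of f. Let p ∈ (0, 1], set θ = (1/2)·min{ 1, √(μ/(pL)) } and η = (1 − θ)/( L·θ·(2 − θ) ), and define the potential Φ(w, x) = f(w) − f(x*) + ((1 + μη)pθ/(2η))·‖x − x*‖². Given x, w ∈ ℝ^d, define u = θx + (1 − θ)w, and for each i ∈ {1,…,n} define g_i = ∇f_i(u) − ∇f_i(w) + ∇f(w), x⁺_i = (1/(1 + μη))·(x + μη·u) − (η/(1 + μη))·g_i, and b_i = θ·x⁺_i + (1 − θ)·w. Then (1/n)∑_{i=1}^n [ p·Φ(b_i, x⁺_i) + (1 − p)·Φ(w, x⁺_i) ] ≤ (1 − (4pθ)/5)·Φ(w, x). -/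

import Mathlib

open scoped RealInnerProductSpace

section SmoothConvex

variable {E : Type*} [NormedAddCommGroup E] [InnerProductSpace ℝ E] [CompleteSpace E]

lemma hasDerivAt_comp_add_smul {f : E → ℝ} (hf : Differentiable ℝ f) (x v : E) (t : ℝ) :
    HasDerivAt (fun s : ℝ => f (x + s • v)) ⟪gradient f (x + t • v), v⟫ t := by
  have hline : HasDerivAt (fun s : ℝ => x + s • v) v t := by
    simpa using ((hasDerivAt_id t).smul_const v).const_add x
  rw [inner_gradient_left]
  exact (hf (x + t • v)).hasFDerivAt.comp_hasDerivAt t hline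

/-- The descent lemma for functions with Lipschitz gradient. -/
lemma le_add_inner_gradient_add_sq {f : E → ℝ} {L : ℝ} (hf : Differentiable ℝ f)
    (hlip : ∀ x y, ‖gradient f x - gradient f y‖ ≤ L * ‖x - y‖) (x y : E) :
    f y ≤ f x + ⟪gradient f x, y - x⟫ + L / 2 * ‖y - x‖ ^ 2 := by
  set v := y - x with hv
  let φ : ℝ → ℝ := fun t => f (x + t • v) - (t * ⟪gradient f x, v⟫ + L / 2 * ‖v‖ ^ 2 * t ^ 2)
  have hφ (t : ℝ) : HasDerivAt φ
      (⟪gradient f (x + t • v), v⟫ - (⟪gradient f x, v⟫ + L * ‖v‖ ^ 2 * t)) t := by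
    refine (hasDerivAt_comp_add_smul hf x v t).sub ?_
    refine (((hasDerivAt_id t).mul_const ⟪gradient f x, v⟫).add
      ((hasDerivAt_pow 2 t).const_mul (L / 2 * ‖v‖ ^ 2))).congr_deriv ?_
    push_cast
    ring
  have hanti : AntitoneOn φ (Set.Ici 0) := by
    refine antitoneOn_of_deriv_nonpos (convex_Ici 0)
      (fun t _ => (hφ t).continuousAt.continuousWithinAt)
      (fun t _ => (hφ t).differentiableAt.differentiableWithinAt) fun t ht => ?_
    rw [interior_Ici, Set.mem_Ioi] at ht
    rw [(hφ t).deriv]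
    have h1 : ‖gradient f (x + t • v) - gradient f x‖ ≤ L * (t * ‖v‖) := by
      simpa [norm_smul, abs_of_pos ht] using hlip (x + t • v) x
    have h2 := real_inner_le_norm (gradient f (x + t • v) - gradient f x) v
    have h3 := mul_le_mul_of_nonneg_right h1 (norm_nonneg v)
    rw [inner_sub_left] at h2
    linarith
  have h := hanti Set.self_mem_Ici (Set.mem_Ici.2 zero_le_one) zero_le_one
  simp only [φ, one_smul, zero_smul, add_zero, hv, add_sub_cancel] at h
  linarith

/-- The gradient inequality for differentiable convex functions. -/
lemma ConvexOn.add_inner_gradient_le {f : E → ℝ} (hconv : ConvexOn ℝ Set.univ f)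
    (hf : Differentiable ℝ f) (x y : E) : f x + ⟪gradient f x, y - x⟫ ≤ f y := by
  have hline : ConvexOn ℝ Set.univ (fun t : ℝ => f (x + t • (y - x))) := by
    have h := hconv.comp_affineMap (AffineMap.lineMap x y : ℝ →ᵃ[ℝ] E)
    simpa [Function.comp_def, AffineMap.lineMap_apply, add_comm] using h
  have h := hline.le_slope_of_hasDerivAt (Set.mem_univ 0) (Set.mem_univ 1) one_pos
    (hasDerivAt_comp_add_smul hf x (y - x) 0)
  simp only [slope_def_field, one_smul, zero_smul, add_zero, add_sub_cancel, sub_zero,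
    div_one] at h
  linarith

/-- The Bregman divergence of a convex function with `L`-Lipschitz gradient controls the squared
distance of the gradients. -/
lemma ConvexOn.norm_gradient_sub_sq_le {f : E → ℝ} {L : ℝ} (hconv : ConvexOn ℝ Set.univ f)
    (hL : 0 < L) (hf : Differentiable ℝ f)
    (hlip : ∀ x y, ‖gradient f x - gradient f y‖ ≤ L * ‖x - y‖) (x y : E) :
    ‖gradient f x - gradient f y‖ ^ 2 ≤ 2 * L * (f y - f x - ⟪gradient f x, y - x⟫) := by
  set a := gradient f x - gradient f y with ha
  have h1 := le_add_inner_gradient_add_sq hf hlip y (y + L⁻¹ • a)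
  have h2 := hconv.add_inner_gradient_le hf x (y + L⁻¹ • a)
  have h3 : y + L⁻¹ • a - x = (y - x) + L⁻¹ • a := by abel
  rw [h3, inner_add_right, inner_smul_right] at h2
  rw [add_sub_cancel_left, inner_smul_right, norm_smul, Real.norm_eq_abs, mul_pow, sq_abs] at h1
  have h4 : ⟪gradient f x, a⟫ - ⟪gradient f y, a⟫ = ‖a‖ ^ 2 := by
    rw [← inner_sub_left, ← ha, real_inner_self_eq_norm_sq]
  have h5 : L⁻¹ * ‖a‖ ^ 2 - L / 2 * (L⁻¹ ^ 2 * ‖a‖ ^ 2) ≤ f y - f x - ⟪gradient f x, y - x⟫ := by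
    have h7 := congrArg (L⁻¹ * ·) h4
    simp only [mul_sub] at h7
    linarith
  have h6 : ‖a‖ ^ 2 = 2 * L * (L⁻¹ * ‖a‖ ^ 2 - L / 2 * (L⁻¹ ^ 2 * ‖a‖ ^ 2)) := by
    field_simp
    ring
  rw [h6]
  gcongr

end SmoothConvex

section InnerProduct

variable {E : Type*} [NormedAddCommGroup E] [InnerProductSpace ℝ E]

/-- The three-point identity for the proximal step with two quadratic terms. -/
lemma two_mul_inner_sub_of_smul_eq {g x u z : E} {η S : ℝ}
    (hz : η • g = x + S • u - (1 + S) • z) (y : E) :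
    2 * (η * ⟪g, z - y⟫) = ‖x - y‖ ^ 2 + S * ‖u - y‖ ^ 2 - (1 + S) * ‖z - y‖ ^ 2
      - ‖z - x‖ ^ 2 - S * ‖z - u‖ ^ 2 := by
  rw [← real_inner_smul_left, hz]
  simp only [← real_inner_self_eq_norm_sq, inner_sub_left, inner_sub_right, inner_add_left,
    real_inner_smul_left]
  rw [real_inner_comm x y, real_inner_comm u y, real_inner_comm z y, real_inner_comm x z,
    real_inner_comm u z]
  ring

/-- A weighted Young inequality for the inner product. -/
lemma inner_le_inv_mul_sq_add {c : ℝ} (hc : 0 < c) (a b : E) :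
    ⟪a, b⟫ ≤ (2 * c)⁻¹ * ‖a‖ ^ 2 + c / 2 * ‖b‖ ^ 2 := by
  have h := real_inner_le_norm a b
  have h1 : (2 * c)⁻¹ * ‖a‖ ^ 2 + c / 2 * ‖b‖ ^ 2 - ‖a‖ * ‖b‖
      = (2 * c)⁻¹ * (‖a‖ - c * ‖b‖) ^ 2 := by
    field_simp
    ring
  have h2 : 0 ≤ (2 * c)⁻¹ * (‖a‖ - c * ‖b‖) ^ 2 := by positivity
  linarith

/-- The sum of squared deviations from the mean is at most the sum of squares. -/
lemma sum_norm_sub_sq_le {n : ℕ} {a : Fin n → E} {m : E} (hm : ∑ i, a i = (n : ℝ) • m) :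
    ∑ i, ‖a i - m‖ ^ 2 ≤ ∑ i, ‖a i‖ ^ 2 := by
  have h : ∑ i, ‖a i - m‖ ^ 2 = ∑ i, ‖a i‖ ^ 2 - n * ‖m‖ ^ 2 := by
    simp only [norm_sub_sq_real, Finset.sum_add_distrib, Finset.sum_sub_distrib, ← Finset.mul_sum,
      ← sum_inner, hm, real_inner_smul_left, real_inner_self_eq_norm_sq]
    simp
    ring
  rw [h]
  have : 0 ≤ (n : ℝ) * ‖m‖ ^ 2 := by positivity
  linarith

lemma norm_average_sub_le {n : ℕ} (hn : 1 ≤ n) {L : ℝ} {G : Fin n → E → E}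
    (hlip : ∀ i x y, ‖G i x - G i y‖ ≤ L * ‖x - y‖) (x y : E) :
    ‖(1 / (n : ℝ)) • ∑ i, G i x - (1 / (n : ℝ)) • ∑ i, G i y‖ ≤ L * ‖x - y‖ := by
  have hn0 : (0 : ℝ) < n := by exact_mod_cast hn
  rw [← smul_sub, ← Finset.sum_sub_distrib, norm_smul, Real.norm_of_nonneg (by positivity)]
  calc 1 / (n : ℝ) * ‖∑ i, (G i x - G i y)‖ ≤ 1 / (n : ℝ) * ∑ _i : Fin n, L * ‖x - y‖ := by
        gcongr
        exact (norm_sum_le _ _).trans (Finset.sum_le_sum fun i _ => hlip i x y)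
    _ = L * ‖x - y‖ := by
        simp
        field_simp

end InnerProduct

section Average

variable {E : Type*} [NormedAddCommGroup E] [InnerProductSpace ℝ E] [CompleteSpace E] {n : ℕ}
  {f : Fin n → E → ℝ}

lemma hasGradientAt_average (hdiff : ∀ i, Differentiable ℝ (f i)) (x : E) :
    HasGradientAt (fun x => (1 / (n : ℝ)) * ∑ i, f i x)
      ((1 / (n : ℝ)) • ∑ i, gradient (f i) x) x := by
  rw [hasGradientAt_iff_hasFDerivAt, map_smul, map_sum]
  exact (HasFDerivAt.fun_sum fun i _ => (hdiff i x).hasGradientAt.hasFDerivAt).const_mul _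

end Average

/-- The contraction factor of the distance term for the step sizes of ANITA. -/
lemma inv_one_add_le_of_step_size {L μ p θ η : ℝ} (hL : 0 < L) (hμ : 0 < μ)
    (hp : p ∈ Set.Ioc (0 : ℝ) 1) (hθ0 : 0 < θ) (hθ2 : θ ≤ 1 / 2)
    (hθμ : 4 * p * L * θ ^ 2 ≤ μ) (hη : η = (1 - θ) / (L * θ * (2 - θ))) :
    1 ≤ (1 - 4 * p * θ / 5) * (1 + μ * η) := by
  obtain ⟨hp0, hp1⟩ := hp
  have hpθ : 0 < p * θ := by positivity
  have hpθ2 : p * θ ≤ 1 / 2 := by nlinarith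
  have hS : 4 * p * θ / 3 ≤ μ * η := by
    have hden : 0 < L * θ * (2 - θ) := by
      have : 0 < 2 - θ := by linarith
      positivity
    rw [hη, ← mul_div_assoc, le_div_iff₀ hden]
    calc 4 * p * θ / 3 * (L * θ * (2 - θ)) = 4 * p * L * θ ^ 2 * ((2 - θ) / 3) := by ring
      _ ≤ μ * (1 - θ) := by
        apply mul_le_mul hθμ <;> linarith
  nlinarith

/-- One-step potential contraction of Theorem 2 (ANITA, strongly convex case):
`E[Φ_{t+1}] ≤ (1 − 4pθ/5) Φ_t`. -/
theorem anita_potential_contraction {d n : ℕ} (hn : 1 ≤ n)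
    (f : Fin n → EuclideanSpace ℝ (Fin d) → ℝ) (L : ℝ) (hL : 0 < L)
    (hdiff : ∀ i, Differentiable ℝ (f i))
    (hconv : ∀ i, ConvexOn ℝ Set.univ (f i))
    (hlip : ∀ i x y, ‖gradient (f i) x - gradient (f i) y‖ ≤ L * ‖x - y‖)
    (F : EuclideanSpace ℝ (Fin d) → ℝ)
    (hF : F = fun x => (1 / (n : ℝ)) * ∑ i, f i x)
    (μ : ℝ) (hμ : 0 < μ)
    (hsc : ∀ x y, F x - F y - ⟪gradient F y, x - y⟫ ≥ (μ / 2) * ‖x - y‖ ^ 2)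
    (xstar : EuclideanSpace ℝ (Fin d)) (hmin : ∀ y, F xstar ≤ F y)
    (p : ℝ) (hp : p ∈ Set.Ioc (0 : ℝ) 1) (θ η : ℝ)
    (hθ : θ = (1 / 2) * min 1 (Real.sqrt (μ / (p * L))))
    (hη : η = (1 - θ) / (L * θ * (2 - θ)))
    (Φ : EuclideanSpace ℝ (Fin d) → EuclideanSpace ℝ (Fin d) → ℝ)
    (hΦ : ∀ w x, Φ w x = F w - F xstar + ((1 + μ * η) * p * θ / (2 * η)) * ‖x - xstar‖ ^ 2)
    (x w : EuclideanSpace ℝ (Fin d))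
    (u : EuclideanSpace ℝ (Fin d)) (hu : u = θ • x + (1 - θ) • w)
    (g xp b : Fin n → EuclideanSpace ℝ (Fin d))
    (hg : ∀ i, g i = gradient (f i) u - gradient (f i) w + gradient F w)
    (hxp : ∀ i, xp i = (1 / (1 + μ * η)) • (x + (μ * η) • u) - (η / (1 + μ * η)) • g i)
    (hb : ∀ i, b i = θ • xp i + (1 - θ) • w) :
    (1 / (n : ℝ)) * ∑ i, (p * Φ (b i) (xp i) + (1 - p) * Φ w (xp i)) ≤
      (1 - 4 * p * θ / 5) * Φ w x := by
  have hn0 : (0 : ℝ) < n := by exact_mod_cast hn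
  have hp0 : 0 < p := hp.1
  have hθ0 : 0 < θ := by
    rw [hθ]
    positivity
  have hθ2 : θ ≤ 1 / 2 := by
    rw [hθ]
    linarith [min_le_left 1 (Real.sqrt (μ / (p * L)))]
  have hθ1 : 0 < 1 - θ := by linarith
  have hθμ : 4 * p * L * θ ^ 2 ≤ μ := by
    have h1 : 2 * θ ≤ Real.sqrt (μ / (p * L)) := by
      rw [hθ]
      linarith [min_le_right 1 (Real.sqrt (μ / (p * L)))]
    rw [Real.le_sqrt (by positivity) (by positivity), le_div_iff₀ (by positivity)] at h1
    linarith
  have hη0 : 0 < η := by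
    have : 0 < 2 - θ := by linarith
    rw [hη]
    positivity
  have hS0 : 0 < 1 + μ * η := by positivity
  have hgradF (y : EuclideanSpace ℝ (Fin d)) :
      HasGradientAt F ((1 / (n : ℝ)) • ∑ i, gradient (f i) y) y := by
    rw [hF]
    exact hasGradientAt_average hdiff y
  have hFdiff : Differentiable ℝ F := fun y => (hgradF y).differentiableAt
  have hFlip : ∀ y z, ‖gradient F y - gradient F z‖ ≤ L * ‖y - z‖ := fun y z => by
    rw [(hgradF y).gradient, (hgradF z).gradient]
    exact norm_average_sub_le hn hlip y z
  have hsumgrad (y : EuclideanSpace ℝ (Fin d)) :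
      ∑ i, gradient (f i) y = (n : ℝ) • gradient F y := by
    rw [(hgradF y).gradient, smul_smul, mul_one_div_cancel hn0.ne', one_smul]
  have hsumf (y : EuclideanSpace ℝ (Fin d)) : ∑ i, f i y = n * F y := by
    rw [hF]
    field_simp
  have hsumg : ∑ i, g i = (n : ℝ) • gradient F u := by
    simp only [hg, Finset.sum_add_distrib, Finset.sum_sub_distrib, hsumgrad]
    simp [Nat.cast_smul_eq_nsmul]
  have hvar : ∑ i, ‖g i - gradient F u‖ ^ 2
      ≤ 2 * L * (n * (F w - F u - ⟪gradient F u, w - u⟫)) := by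
    calc ∑ i, ‖g i - gradient F u‖ ^ 2
        = ∑ i, ‖(gradient (f i) u - gradient (f i) w) - (gradient F u - gradient F w)‖ ^ 2 := by
          refine Finset.sum_congr rfl fun i _ => ?_
          rw [hg i]
          congr 2
          abel
      _ ≤ ∑ i, ‖gradient (f i) u - gradient (f i) w‖ ^ 2 := by
          apply sum_norm_sub_sq_le
          rw [Finset.sum_sub_distrib, hsumgrad, hsumgrad, smul_sub]
      _ ≤ ∑ i, 2 * L * (f i w - f i u - ⟪gradient (f i) u, w - u⟫) :=
          Finset.sum_le_sum fun i _ =>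
            (hconv i).norm_gradient_sub_sq_le hL (hdiff i) (hlip i) u w
      _ = 2 * L * (n * (F w - F u - ⟪gradient F u, w - u⟫)) := by
          rw [← Finset.mul_sum, Finset.sum_sub_distrib, Finset.sum_sub_distrib, hsumf, hsumf,
            ← sum_inner, hsumgrad, real_inner_smul_left]
          ring
  have hθη : θ / (2 * η) = L * θ ^ 2 / 2 + L / (1 - θ) / 2 * θ ^ 2 := by
    have : 2 - θ ≠ 0 := by linarith
    rw [hη]
    field_simp
    ring
  -- the bound for a single index
  have hstep (i : Fin n) : F (b i) + (1 + μ * η) * θ / (2 * η) * ‖xp i - xstar‖ ^ 2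
      ≤ F u + (1 - θ) / (2 * L) * ‖g i - gradient F u‖ ^ 2 + θ * ⟪g i, xstar - x⟫
        + θ / (2 * η) * ‖x - xstar‖ ^ 2 + θ * μ / 2 * ‖u - xstar‖ ^ 2 := by
    have hbu : b i - u = θ • (xp i - x) := by
      rw [hb, hu]
      module
    have hdesc := le_add_inner_gradient_add_sq hFdiff hFlip u (b i)
    rw [hbu, inner_smul_right, norm_smul, mul_pow, Real.norm_eq_abs, sq_abs] at hdesc
    have hyoung := inner_le_inv_mul_sq_add (div_pos hL hθ1) (gradient F u - g i) (θ • (xp i - x))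
    rw [inner_smul_right, norm_smul, mul_pow, Real.norm_eq_abs, sq_abs, inner_sub_left,
      norm_sub_rev, show (2 * (L / (1 - θ)))⁻¹ = (1 - θ) / (2 * L) by field_simp] at hyoung
    have hprox : η • g i = x + (μ * η) • u - (1 + μ * η) • xp i := by
      rw [hxp, smul_sub, smul_smul, smul_smul, mul_one_div_cancel hS0.ne',
        mul_div_cancel₀ _ hS0.ne']
      module
    have hthree := two_mul_inner_sub_of_smul_eq hprox xstar
    have hthree' : θ * ⟪g i, xp i - xstar⟫ = θ / (2 * η) * ‖x - xstar‖ ^ 2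
        + θ * μ / 2 * ‖u - xstar‖ ^ 2 - (1 + μ * η) * θ / (2 * η) * ‖xp i - xstar‖ ^ 2
        - θ / (2 * η) * ‖xp i - x‖ ^ 2 - θ * μ / 2 * ‖xp i - u‖ ^ 2 := by
      have : θ * ⟪g i, xp i - xstar⟫ = θ / (2 * η) * (2 * (η * ⟪g i, xp i - xstar⟫)) := by
        field_simp
      rw [this, hthree]
      field_simp
    have hsplit : ⟪g i, xp i - x⟫ = ⟪g i, xp i - xstar⟫ + ⟪g i, xstar - x⟫ := by
      rw [← inner_add_right, sub_add_sub_cancel]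
    have hpos : 0 ≤ θ * μ / 2 * ‖xp i - u‖ ^ 2 := by positivity
    have hcoef : θ / (2 * η) * ‖xp i - x‖ ^ 2 = L / 2 * (θ ^ 2 * ‖xp i - x‖ ^ 2)
        + L / (1 - θ) / 2 * (θ ^ 2 * ‖xp i - x‖ ^ 2) := by
      rw [hθη]
      ring
    have hsplit' : θ * ⟪g i, xp i - x⟫ = θ * ⟪g i, xp i - xstar⟫ + θ * ⟪g i, xstar - x⟫ := by
      rw [hsplit, mul_add]
    linarith
  have hmean : (1 / (n : ℝ)) * ∑ i, (F (b i) + (1 + μ * η) * θ / (2 * η) * ‖xp i - xstar‖ ^ 2)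
      ≤ (1 - θ) * F w + θ * F xstar + θ / (2 * η) * ‖x - xstar‖ ^ 2 := by
    have hlin : θ * ⟪gradient F u, xstar - x⟫
        = θ * ⟪gradient F u, xstar - u⟫ + (1 - θ) * ⟪gradient F u, w - u⟫ := by
      simp only [← inner_smul_right, ← inner_add_right]
      congr 1
      rw [hu]
      module
    have hstrong := mul_le_mul_of_nonneg_left (hsc xstar u).le hθ0.le
    rw [norm_sub_rev] at hstrong
    have hvar' : (1 - θ) / (2 * L) * ∑ i, ‖g i - gradient F u‖ ^ 2
        ≤ n * ((1 - θ) * (F w - F u - ⟪gradient F u, w - u⟫)) := by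
      calc _ ≤ (1 - θ) / (2 * L) * (2 * L * (n * (F w - F u - ⟪gradient F u, w - u⟫))) := by
            gcongr
        _ = _ := by field_simp
    have hsum := Finset.sum_le_sum fun i (_ : i ∈ Finset.univ) => hstep i
    rw [one_div, inv_mul_le_iff₀ hn0]
    refine hsum.trans ?_
    simp only [Finset.sum_add_distrib, ← Finset.mul_sum, ← sum_inner, hsumg, Finset.sum_const,
      Finset.card_univ, Fintype.card_fin, nsmul_eq_mul, real_inner_smul_left]
    have hbase : F u + (1 - θ) * (F w - F u - ⟪gradient F u, w - u⟫)
        + θ * ⟪gradient F u, xstar - x⟫ + θ / (2 * η) * ‖x - xstar‖ ^ 2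
        + θ * μ / 2 * ‖u - xstar‖ ^ 2
        ≤ (1 - θ) * F w + θ * F xstar + θ / (2 * η) * ‖x - xstar‖ ^ 2 := by
      linarith
    have := mul_le_mul_of_nonneg_left hbase hn0.le
    linarith
  have hlhs : (1 / (n : ℝ)) * ∑ i, (p * Φ (b i) (xp i) + (1 - p) * Φ w (xp i))
      = p * ((1 / (n : ℝ)) * ∑ i, (F (b i) + (1 + μ * η) * θ / (2 * η) * ‖xp i - xstar‖ ^ 2))
        + (1 - p) * F w - F xstar := by
    have hterm (i : Fin n) : p * Φ (b i) (xp i) + (1 - p) * Φ w (xp i)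
        = p * (F (b i) + (1 + μ * η) * θ / (2 * η) * ‖xp i - xstar‖ ^ 2)
          + ((1 - p) * F w - F xstar) := by
      rw [hΦ, hΦ]
      ring
    simp only [hterm]
    rw [Finset.sum_add_distrib, ← Finset.mul_sum, Finset.sum_const, Finset.card_univ,
      Fintype.card_fin, nsmul_eq_mul]
    generalize ∑ i, (F (b i) + (1 + μ * η) * θ / (2 * η) * ‖xp i - xstar‖ ^ 2) = T
    field_simp
    ring
  rw [hlhs, hΦ]
  have hfactor := inv_one_add_le_of_step_size hL hμ hp hθ0 hθ2 hθμ hη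
  have hdist : p * θ / (2 * η) * ‖x - xstar‖ ^ 2
      ≤ (1 - 4 * p * θ / 5) * ((1 + μ * η) * p * θ / (2 * η) * ‖x - xstar‖ ^ 2) := by
    have := mul_le_mul_of_nonneg_left hfactor
      (by positivity : 0 ≤ p * θ / (2 * η) * ‖x - xstar‖ ^ 2)
    linarith [this, show p * θ / (2 * η) * ‖x - xstar‖ ^ 2 * ((1 - 4 * p * θ / 5) * (1 + μ * η))
      = (1 - 4 * p * θ / 5) * ((1 + μ * η) * p * θ / (2 * η) * ‖x - xstar‖ ^ 2) by ring]
  have hgap : 0 ≤ p * θ * (F w - F xstar) :=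
    mul_nonneg (by positivity) (sub_nonneg.2 (hmin w))
  have hmean' := mul_le_mul_of_nonneg_left hmean hp0.le
  have hexpand : p * ((1 - θ) * F w + θ * F xstar + θ / (2 * η) * ‖x - xstar‖ ^ 2)
      = (p - p * θ) * F w + p * θ * F xstar + p * θ / (2 * η) * ‖x - xstar‖ ^ 2 := by ring
  linarith
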